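/- For every λ ∈ ℝ, ∫_ℝ (e^{iλz} − 1 − iλz) dν_ε(z) → ∫_ℝ (e^{iλz} − 1 − iλz) dν^{(α)}(z) as ε → 0+, where ν_ε is ε'(ε) times the pushforward of ν under the map z ↦ (ε/ε''(ε))·z, and ν^{(α)} is the measure on ℝ with density z ↦ (C₊·1_{(0,∞)}(z) + C₋·1_{(−∞,0)}(z))·α·|z|^{−1−α} with respect to Lebesgue measure. -/

import Mathlib

open Filter Set MeasureTheory

noncomputable def gfun (lam z : ℝ) : ℂ :=
  Complex.exp (Complex.I * (lam : ℂ) * (z : ℂ)) - 1 - Complex.I * (lam : ℂ) * (z : ℂ)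

noncomputable def phi (lam t : ℝ) : ℂ :=
  Complex.I * (lam : ℂ) * (Complex.exp (Complex.I * (lam : ℂ) * (t : ℂ)) - 1)

noncomputable def Dfun (a b t : ℝ) : ℝ := if t ≤ 1 then t ^ (-b) else t ^ (-a)

lemma phi_cont (lam : ℝ) : Continuous (phi lam) := by unfold phi; fun_prop
lemma g_cont (lam : ℝ) : Continuous (gfun lam) := by unfold gfun; fun_prop

lemma g_int (lam z : ℝ) : ∫ t in (0:ℝ)..z, phi lam t = gfun lam z := by
  have h : ∀ t ∈ uIcc (0:ℝ) z, HasDerivAt (gfun lam) (phi lam t) t := by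
    intro t _
    have h1 : HasDerivAt (fun t : ℝ => Complex.I * (lam : ℂ) * (t : ℂ)) (Complex.I * (lam : ℂ)) t := by
      simpa using (Complex.ofRealCLM.hasDerivAt (x := t)).const_mul (Complex.I * (lam : ℂ))
    have h2 := (h1.cexp.sub_const 1).sub h1
    refine h2.congr_deriv ?_
    unfold phi; ring
  rw [intervalIntegral.integral_eq_sub_of_hasDerivAt h ((phi_cont lam).intervalIntegrable _ _)]
  simp [gfun]

lemma phi_bound (lam : ℝ) : ∃ K, 0 ≤ K ∧ ∀ t > 0, ‖phi lam t‖ ≤ K * min t 1 := by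
  refine ⟨|lam| * (|lam| + 2), by positivity, fun t ht => ?_⟩
  have e : Complex.I * (lam : ℂ) * (t : ℂ) = Complex.I * ((lam * t : ℝ) : ℂ) := by push_cast; ring
  have h1 : ‖Complex.exp (Complex.I * (lam : ℂ) * (t : ℂ)) - 1‖ ≤ |lam| * t := by
    rw [e]
    have := Real.norm_exp_I_mul_ofReal_sub_one_le (x := lam * t)
    simpa [abs_mul, abs_of_pos ht] using this
  have h2 : ‖Complex.exp (Complex.I * (lam : ℂ) * (t : ℂ)) - 1‖ ≤ 2 := by
    refine (norm_sub_le _ _).trans ?_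
    rw [e, mul_comm, Complex.norm_exp_ofReal_mul_I]; norm_num
  have h3 : ‖Complex.exp (Complex.I * (lam : ℂ) * (t : ℂ)) - 1‖ ≤ (|lam| + 2) * min t 1 := by
    rcases le_total t 1 with h | h
    · rw [min_eq_left h]; nlinarith [abs_nonneg lam]
    · rw [min_eq_right h]; nlinarith [abs_nonneg lam]
  unfold phi
  rw [norm_mul, norm_mul, Complex.norm_I, Complex.norm_real, Real.norm_eq_abs, one_mul, mul_assoc |lam|]
  exact mul_le_mul_of_nonneg_left h3 (abs_nonneg _)

lemma D_nonneg (a b t : ℝ) (ht : 0 < t) : 0 ≤ Dfun a b t := by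
  unfold Dfun; split_ifs <;> positivity

lemma D_meas (a b : ℝ) : Measurable (Dfun a b) := by
  unfold Dfun
  exact Measurable.ite measurableSet_Iic (by fun_prop) (by fun_prop)

lemma D_int (a b : ℝ) (ha : 1 < a) (hb : b < 2) :
    IntegrableOn (fun t => min t 1 * Dfun a b t) (Ioi 0) := by
  rw [← Ioc_union_Ioi_eq_Ioi (zero_le_one (α := ℝ)), integrableOn_union]
  constructor
  · have h : IntegrableOn (fun t : ℝ => t ^ (1 - b)) (Ioc 0 1) := by
      rw [← intervalIntegrable_iff_integrableOn_Ioc_of_le zero_le_one]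
      exact intervalIntegral.intervalIntegrable_rpow' (by linarith)
    refine h.congr_fun (fun t ht => ?_) measurableSet_Ioc
    simp only [Dfun, if_pos ht.2, min_eq_left ht.2]
    rw [sub_eq_add_neg, Real.rpow_add ht.1, Real.rpow_one]
  · have h : IntegrableOn (fun t : ℝ => t ^ (-a)) (Ioi 1) :=
      integrableOn_Ioi_rpow_of_lt (by linarith) one_pos
    refine h.congr_fun (fun t ht => ?_) measurableSet_Ioi
    have ht : 1 < t := ht
    simp only [Dfun, if_neg (not_le.2 ht), min_eq_right (le_of_lt ht), one_mul]

lemma tail_meas (ρ : Measure ℝ) : Measurable (fun t => (ρ (Ici t)).toReal) := by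
  have : Antitone (fun t => ρ (Ici t)) := fun s t h => measure_mono (Ici_subset_Ici.2 h)
  exact this.measurable.ennreal_toReal

lemma fubini (ρ : Measure ℝ) [SFinite ρ] (hfin : ∀ t > 0, ρ (Ici t) ≠ ⊤) (lam : ℝ)
    (hint : IntegrableOn (fun t => min t 1 * (ρ (Ici t)).toReal) (Ioi 0)) :
    IntegrableOn (gfun lam) (Ioi 0) ρ ∧
    ∫ z in Ioi 0, gfun lam z ∂ρ = ∫ t in Ioi 0, phi lam t * ((ρ (Ici t)).toReal : ℂ) := by
  obtain ⟨K, hK, hphi⟩ := phi_bound lam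
  let f : ℝ → ℝ → ℂ := fun z t => (Iic z).indicator (phi lam) t
  have hf' : ∀ z t, f z t = (Ici t).indicator (fun _ => phi lam t) z := by
    intro z t; simp [f, indicator]
  have hz : ∀ z > 0, ∫ t in Ioi 0, f z t = gfun lam z := by
    intro z hz
    simp only [f]
    rw [integral_indicator measurableSet_Iic, Measure.restrict_restrict measurableSet_Iic,
      Iic_inter_Ioi, ← intervalIntegral.integral_of_le hz.le, g_int]
  have hin : ∀ t > 0, Ici t ∩ Ioi (0:ℝ) = Ici t := fun t ht =>
    inter_eq_left.2 fun x hx => lt_of_lt_of_le ht hx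
  have ht : ∀ t > 0, ∫ z in Ioi 0, f z t ∂ρ = phi lam t * ((ρ (Ici t)).toReal : ℂ) := by
    intro t ht
    simp only [hf']
    rw [integral_indicator measurableSet_Ici, Measure.restrict_restrict measurableSet_Ici, hin t ht,
      setIntegral_const, Measure.real, Complex.real_smul, mul_comm]
  have hmeas : Measurable (Function.uncurry f) := by
    have : Function.uncurry f = {p : ℝ × ℝ | p.2 ≤ p.1}.indicator (fun p => phi lam p.2) := by
      ext p; simp [f, indicator, Function.uncurry]
    rw [this]
    exact ((phi_cont lam).measurable.comp measurable_snd).indicator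
      (measurableSet_le measurable_snd measurable_fst)
  have hI : Integrable (Function.uncurry f) ((ρ.restrict (Ioi 0)).prod (volume.restrict (Ioi 0))) := by
    rw [integrable_prod_iff' hmeas.aestronglyMeasurable]
    constructor
    · filter_upwards [ae_restrict_mem measurableSet_Ioi] with t ht
      simp only [Function.uncurry, hf']
      rw [integrable_indicator_iff measurableSet_Ici]
      rw [IntegrableOn, Measure.restrict_restrict measurableSet_Ici, hin t ht]
      exact integrableOn_const (hfin t ht)
    · have : ∀ t ∈ Ioi (0:ℝ), ∫ z in Ioi 0, ‖f z t‖ ∂ρ = ‖phi lam t‖ * (ρ (Ici t)).toReal := by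
        intro t ht
        simp only [hf', norm_indicator_eq_indicator_norm]
        rw [integral_indicator measurableSet_Ici, Measure.restrict_restrict measurableSet_Ici,
          hin t ht, setIntegral_const, Measure.real, smul_eq_mul, mul_comm]
      refine IntegrableOn.congr_fun (f := fun t => ‖phi lam t‖ * (ρ (Ici t)).toReal) ?_
        (fun t ht => (this t ht).symm) measurableSet_Ioi
      refine Integrable.mono' (hint.const_mul K)
        ((phi_cont lam).norm.measurable.mul (tail_meas ρ)).aestronglyMeasurable ?_
      filter_upwards [ae_restrict_mem measurableSet_Ioi] with t ht
      rw [Real.norm_of_nonneg (by positivity), ← mul_assoc]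
      gcongr
      exact hphi t ht
  constructor
  · refine IntegrableOn.congr_fun (f := fun z => ∫ t in Ioi 0, f z t) hI.integral_prod_left
      (fun z h => hz z h) measurableSet_Ioi
  · rw [← setIntegral_congr_fun measurableSet_Ioi (fun z h => hz z h),
      ← setIntegral_congr_fun measurableSet_Ioi (fun z h => ht z h)]
    exact integral_integral_swap hI

lemma oneside {l : Filter ℝ} [l.IsCountablyGenerated] (ρ : ℝ → Measure ℝ) (a b α C K lam : ℝ)
    (ha : 1 < a) (hb : b < 2)
    (hs : ∀ᶠ ε in l, SFinite (ρ ε)) (hfin : ∀ᶠ ε in l, ∀ t > 0, ρ ε (Ici t) ≠ ⊤)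
    (hbd : ∀ᶠ ε in l, ∀ t > 0, (ρ ε (Ici t)).toReal ≤ K * Dfun a b t)
    (hlim : ∀ t > 0, Tendsto (fun ε => (ρ ε (Ici t)).toReal) l (nhds (C * t ^ (-α)))) :
    (∀ᶠ ε in l, IntegrableOn (gfun lam) (Ioi 0) (ρ ε)) ∧
    Tendsto (fun ε => ∫ z in Ioi 0, gfun lam z ∂(ρ ε)) l
      (nhds (∫ t in Ioi 0, phi lam t * ((C * t ^ (-α) : ℝ) : ℂ))) := by
  obtain ⟨K', hK', hphi⟩ := phi_bound lam
  have key : ∀ᶠ ε in l, IntegrableOn (gfun lam) (Ioi 0) (ρ ε) ∧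
    ∫ z in Ioi 0, gfun lam z ∂(ρ ε) = ∫ t in Ioi 0, phi lam t * ((ρ ε (Ici t)).toReal : ℂ) := by
    filter_upwards [hs, hfin, hbd] with ε h1 h2 h3
    refine fubini (ρ ε) h2 lam ?_
    refine Integrable.mono' ((D_int a b ha hb).const_mul K)
      ((measurable_id.min measurable_const).mul (tail_meas (ρ ε))).aestronglyMeasurable ?_
    filter_upwards [ae_restrict_mem measurableSet_Ioi] with t ht
    have ht' : (0:ℝ) < t := ht
    have hm : 0 ≤ min t 1 := le_min ht'.le zero_le_one
    rw [Real.norm_of_nonneg (by positivity)]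
    calc _ ≤ min t 1 * (K * Dfun a b t) := by gcongr; exact h3 t ht
      _ = _ := by ring
  refine ⟨key.mono fun ε h => h.1, ?_⟩
  rw [tendsto_congr' (key.mono fun ε h => h.2)]
  refine tendsto_integral_filter_of_dominated_convergence
    (fun t => K' * (K * (min t 1 * Dfun a b t))) ?_ ?_ ?_ ?_
  · refine Eventually.of_forall fun ε => ?_
    exact ((phi_cont lam).measurable.mul
      (Complex.measurable_ofReal.comp (tail_meas (ρ ε)))).aestronglyMeasurable
  · filter_upwards [hbd] with ε h3
    filter_upwards [ae_restrict_mem measurableSet_Ioi] with t ht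
    have ht' : (0:ℝ) < t := ht
    have hm : 0 ≤ min t 1 := le_min ht'.le zero_le_one
    rw [norm_mul, Complex.norm_real, Real.norm_of_nonneg (by positivity)]
    calc _ ≤ (K' * min t 1) * (K * Dfun a b t) := by
          gcongr
          · exact hphi t ht
          · exact h3 t ht
      _ = _ := by ring
  · exact ((D_int a b ha hb).const_mul K).const_mul K'
  · filter_upwards [ae_restrict_mem measurableSet_Ioi] with t ht
    exact ((Complex.continuous_ofReal.tendsto _).comp (hlim t ht)).const_mul _

lemma twoside {l : Filter ℝ} [l.IsCountablyGenerated] (ρ : ℝ → Measure ℝ) (a b α Cp Cm K lam : ℝ)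
    (ha : 1 < a) (hb : b < 2)
    (hs : ∀ᶠ ε in l, SFinite (ρ ε)) (hfin : ∀ᶠ ε in l, ∀ t > 0, ρ ε (Ici t) ≠ ⊤)
    (hfin' : ∀ᶠ ε in l, ∀ t > 0, ρ ε (Iic (-t)) ≠ ⊤)
    (hbd : ∀ᶠ ε in l, ∀ t > 0, (ρ ε (Ici t)).toReal ≤ K * Dfun a b t)
    (hbd' : ∀ᶠ ε in l, ∀ t > 0, (ρ ε (Iic (-t))).toReal ≤ K * Dfun a b t)
    (hlim : ∀ t > 0, Tendsto (fun ε => (ρ ε (Ici t)).toReal) l (nhds (Cp * t ^ (-α))))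
    (hlim' : ∀ t > 0, Tendsto (fun ε => (ρ ε (Iic (-t))).toReal) l (nhds (Cm * t ^ (-α)))) :
    Tendsto (fun ε => ∫ z, gfun lam z ∂(ρ ε)) l
      (nhds ((∫ t in Ioi 0, phi lam t * ((Cp * t ^ (-α) : ℝ) : ℂ)) +
        (∫ t in Ioi 0, phi (-lam) t * ((Cm * t ^ (-α) : ℝ) : ℂ)))) := by
  have hmap : ∀ ε t, ((ρ ε).map (fun x => -x)) (Ici t) = ρ ε (Iic (-t)) := by
    intro ε t
    rw [Measure.map_apply measurable_neg measurableSet_Ici]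
    congr 1; ext x; simp
  obtain ⟨i1, t1⟩ := oneside ρ a b α Cp K lam ha hb hs hfin hbd hlim
  obtain ⟨i2, t2⟩ := oneside (fun ε => (ρ ε).map (fun x => -x)) a b α Cm K (-lam) ha hb
    (hs.mono fun ε h => by infer_instance) (by simpa only [hmap]) (by simpa only [hmap])
    (by simpa only [hmap])
  have hpre : (fun x : ℝ => -x) ⁻¹' Ioi 0 = Iio 0 := by ext x; simp
  have hg : ∀ z, gfun (-lam) (-z) = gfun lam z := by intro z; simp [gfun]
  refine (t1.add t2).congr' ?_
  have hemb : MeasurableEmbedding (fun x : ℝ => -x) := (MeasurableEquiv.neg ℝ).measurableEmbedding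
  filter_upwards [i1, i2] with ε h1 h2
  rw [hemb.integrableOn_map_iff, hpre] at h2
  rw [hemb.setIntegral_map, hpre]
  have h2' : IntegrableOn (gfun lam) (Iio 0) (ρ ε) := by
    refine h2.congr_fun (fun z _ => hg z) measurableSet_Iio
  simp only [hg]
  rw [← setIntegral_union (s := Ioi 0) (t := Iio 0) (disjoint_left.2 fun x hx hx' => lt_asymm (mem_Ioi.1 hx) (mem_Iio.1 hx')) measurableSet_Iio h1 h2']
  refine setIntegral_eq_integral_of_forall_compl_eq_zero fun x hx => ?_
  have : x = 0 := by
    simp only [mem_union, mem_Ioi, mem_Iio, not_or, not_lt] at hx; linarith [hx.1, hx.2]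
  simp [this, gfun]

lemma potterA (H : ℝ → ℝ) (a z0 : ℝ) (ha : 0 < a) (hanti : ∀ x y, 0 < x → x ≤ y → H y ≤ H x)
    (hd : ∀ z, 0 < z → z ≤ z0 → H (2 * z) ≤ 2 ^ (-a) * H z) (n : ℕ) :
    ∀ x y, 0 < x → x ≤ y → y ≤ 2 ^ n * x → y ≤ z0 → 0 ≤ H x → y ^ a * H y ≤ 2 ^ a * (x ^ a * H x) := by
  induction n with
  | zero =>
    intro x y hx hxy h _ h0
    have : y = x := le_antisymm (by simpa using h) hxy
    subst this
    exact le_mul_of_one_le_left (mul_nonneg (by positivity) h0) (Real.one_le_rpow one_le_two ha.le)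
  | succ n ih =>
    intro x y hx hxy h hz h0
    have hy : 0 < y := hx.trans_le hxy
    rcases le_total y (2 * x) with h2 | h2
    · calc y ^ a * H y ≤ (2 * x) ^ a * H x := by
            refine mul_le_mul_of_nonneg ?_ (hanti x y hx hxy) ?_ ?_
            · gcongr
            · positivity
            · exact h0
        _ = _ := by rw [Real.mul_rpow (by norm_num) hx.le]; ring
    · have h3 := ih x (y / 2) hx (by linarith) (by rw [pow_succ] at h; linarith) (by linarith) h0
      refine le_trans ?_ h3
      have h4 := hd (y / 2) (by positivity) (by linarith)
      rw [show 2 * (y / 2) = y by ring] at h4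
      calc y ^ a * H y ≤ y ^ a * (2 ^ (-a) * H (y / 2)) := by gcongr
        _ = _ := by rw [Real.div_rpow hy.le (by norm_num), Real.rpow_neg (by norm_num)]; ring

lemma potterB (H : ℝ → ℝ) (b z0 : ℝ) (hb : 0 < b) (hanti : ∀ x y, 0 < x → x ≤ y → H y ≤ H x)
    (h0 : ∀ x, 0 ≤ H x)
    (hd : ∀ z, 0 < z → z ≤ z0 → H z ≤ 2 ^ b * H (2 * z)) (n : ℕ) :
    ∀ x y, 0 < x → x ≤ y → y ≤ 2 ^ n * x → y ≤ z0 → x ^ b * H x ≤ 2 ^ b * (y ^ b * H y) := by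
  induction n with
  | zero =>
    intro x y hx hxy h _
    have : y = x := le_antisymm (by simpa using h) hxy
    subst this
    exact le_mul_of_one_le_left (mul_nonneg (by positivity) (h0 _)) (Real.one_le_rpow one_le_two hb.le)
  | succ n ih =>
    intro x y hx hxy h hz
    have hy : 0 < y := hx.trans_le hxy
    have h4 := hd (y / 2) (by positivity) (by linarith)
    rw [show 2 * (y / 2) = y by ring] at h4
    rcases le_total y (2 * x) with h2 | h2
    · have h5 := hanti (y / 2) x (by positivity) (by linarith)
      calc x ^ b * H x ≤ y ^ b * (2 ^ b * H y) := by
            refine mul_le_mul_of_nonneg ?_ (h5.trans h4) (by positivity) ?_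
            · gcongr
            · exact mul_nonneg (by positivity) (h0 _)
        _ = _ := by ring
    · have h3 := ih x (y / 2) hx (by linarith) (by rw [pow_succ] at h; linarith) (by linarith)
      refine h3.trans ?_
      gcongr 2 ^ b * ?_
      calc (y / 2) ^ b * H (y / 2) ≤ (y / 2) ^ b * (2 ^ b * H y) := by gcongr
        _ = _ := by rw [Real.div_rpow hy.le (by norm_num)]; field_simp

lemma potter (H : ℝ → ℝ) (a b z0 M : ℝ) (ha : 0 < a) (hb : 0 < b) (hz0 : 0 < z0) (hzM : z0 ≤ M)
    (hanti : ∀ x y, 0 < x → x ≤ y → H y ≤ H x)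
    (h0 : ∀ x, 0 ≤ H x) (hM : ∀ x, M < x → H x = 0)
    (hA : ∀ z, 0 < z → z ≤ z0 → H (2 * z) ≤ 2 ^ (-a) * H z)
    (hB : ∀ z, 0 < z → z ≤ z0 → H z ≤ 2 ^ b * H (2 * z)) :
    ∃ K, 0 ≤ K ∧ ∀ x, 0 < x → x ≤ z0 → ∀ t > 0, H (t * x) ≤ K * Dfun a b t * H x := by
  have hn : ∀ x y : ℝ, 0 < x → ∃ n : ℕ, y ≤ 2 ^ n * x := by
    intro x y hx
    obtain ⟨n, hn⟩ := pow_unbounded_of_one_lt (y / x) (one_lt_two (α := ℝ))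
    exact ⟨n, by rw [div_lt_iff₀ hx] at hn; exact hn.le⟩
  have hMp : 0 < M := hz0.trans_le hzM
  refine ⟨2 ^ b + 2 ^ a + 2 ^ a * (M / z0) ^ a, by positivity, fun x hx hxz t ht => ?_⟩
  have hHx := h0 x
  have htx : 0 < t * x := by positivity
  rw [mul_assoc]
  unfold Dfun
  split_ifs with h1
  · obtain ⟨n, hn⟩ := hn (t * x) x htx
    have := potterB H b z0 hb hanti h0 hB n (t * x) x htx (by nlinarith) hn hxz
    have h2 : H (t * x) ≤ 2 ^ b * (t ^ (-b) * H x) := by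
      rw [Real.mul_rpow ht.le hx.le] at this
      have e : H (t * x) = (t ^ b * x ^ b * H (t * x)) * (t ^ (-b) * x ^ (-b)) := by
        rw [Real.rpow_neg ht.le, Real.rpow_neg hx.le]; field_simp
      rw [e]
      calc _ ≤ (2 ^ b * (x ^ b * H x)) * (t ^ (-b) * x ^ (-b)) := by gcongr
        _ = _ := by rw [Real.rpow_neg hx.le]; field_simp
    have : 0 ≤ (2 ^ a + 2 ^ a * (M / z0) ^ a) * (t ^ (-b) * H x) := by positivity
    nlinarith
  · push Not at h1
    have gen : ∀ s, 1 ≤ s → s * x ≤ z0 → H (s * x) ≤ 2 ^ a * (s ^ (-a) * H x) := by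
      intro s hs hsz
      have hs0 : 0 < s := by linarith
      obtain ⟨n, hn⟩ := hn x (s * x) hx
      have := potterA H a z0 ha hanti hA n x (s * x) hx (by nlinarith) hn hsz (h0 x)
      rw [Real.mul_rpow hs0.le hx.le] at this
      have e : H (s * x) = (s ^ a * x ^ a * H (s * x)) * (s ^ (-a) * x ^ (-a)) := by
        rw [Real.rpow_neg hs0.le, Real.rpow_neg hx.le]; field_simp
      rw [e]
      calc _ ≤ (2 ^ a * (x ^ a * H x)) * (s ^ (-a) * x ^ (-a)) := by gcongr
        _ = _ := by rw [Real.rpow_neg hx.le]; field_simp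
    rcases le_or_gt (t * x) z0 with h2 | h2
    · have h3 := gen t h1.le h2
      have : 0 ≤ (2 ^ b + 2 ^ a * (M / z0) ^ a) * (t ^ (-a) * H x) := by positivity
      nlinarith
    rcases le_or_gt (t * x) M with h4 | h4
    · have h3 := gen (z0 / x) ((one_le_div hx).2 hxz) (by field_simp; rfl)
      rw [show z0 / x * x = z0 by field_simp] at h3
      have h5 := hanti z0 (t * x) hz0 h2.le
      have h6 : (z0 / x) ^ (-a) ≤ (M / z0) ^ a * t ^ (-a) := by
        rw [Real.rpow_neg (by positivity), ← Real.inv_rpow (by positivity), inv_div,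
          Real.rpow_neg ht.le, ← Real.inv_rpow ht.le, ← Real.mul_rpow (by positivity) (by positivity)]
        apply Real.rpow_le_rpow (by positivity) _ ha.le
        rw [div_le_iff₀ hz0]
        field_simp
        linarith
      have h7 : H (t * x) ≤ 2 ^ a * ((M / z0) ^ a * t ^ (-a) * H x) :=
        (h5.trans h3).trans (by gcongr)
      have : 0 ≤ (2 ^ b + 2 ^ a) * (t ^ (-a) * H x) := by positivity
      nlinarith
    · rw [hM _ h4]; positivity

lemma ratio (H l : ℝ → ℝ) (C α : ℝ) (hC : 0 < C) (hl : ∀ x > (0:ℝ), 0 < l x)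
    (hsv : ∀ lam > (0:ℝ), Tendsto (fun x => l (lam * x) / l x) atTop (nhds 1))
    (hL : Tendsto (fun z => z ^ α * H z / l (1 / z)) (nhdsWithin 0 (Ioi 0)) (nhds C)) :
    Tendsto (fun z => H (2 * z) / H z) (nhdsWithin 0 (Ioi 0)) (nhds (2 ^ (-α))) ∧
    ∀ᶠ z in nhdsWithin 0 (Ioi 0), 0 < H z := by
  have hpos : ∀ᶠ z in nhdsWithin 0 (Ioi 0), 0 < H z := by
    filter_upwards [hL.eventually (lt_mem_nhds hC), self_mem_nhdsWithin] with z h1 hz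
    have hz : (0:ℝ) < z := hz
    have := hl (1 / z) (by positivity)
    rw [lt_div_iff₀ this, zero_mul] at h1
    exact (pos_iff_pos_of_mul_pos h1).1 (by positivity)
  refine ⟨?_, hpos⟩
  have t2 : Tendsto (fun z : ℝ => 2 * z) (nhdsWithin 0 (Ioi 0)) (nhdsWithin 0 (Ioi 0)) := by
    refine tendsto_nhdsWithin_iff.2 ⟨?_, ?_⟩
    · have : Tendsto (fun z : ℝ => 2 * z) (nhds 0) (nhds (2 * 0)) := by
        exact (continuous_const.mul continuous_id).tendsto _
      rw [mul_zero] at this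
      exact this.mono_left nhdsWithin_le_nhds
    · filter_upwards [self_mem_nhdsWithin] with z hz
      have hz : (0:ℝ) < z := hz
      show (0:ℝ) < 2 * z
      positivity
  have h1 := (hL.comp t2).div hL hC.ne'
  have h2 := (hsv (1/2) (by norm_num)).comp tendsto_inv_nhdsGT_zero
  have h3 := (h1.mul h2).mul_const ((2:ℝ) ^ (-α))
  rw [div_self hC.ne', one_mul, one_mul] at h3
  refine h3.congr' ?_
  filter_upwards [hpos, self_mem_nhdsWithin] with z h0 hz
  have hz : (0:ℝ) < z := hz
  have e : 1 / (2 * z) = 1 / 2 * z⁻¹ := by field_simp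
  have p1 := hl (1 / 2 * z⁻¹) (by positivity)
  have p2 := hl (z⁻¹) (by positivity)
  simp only [Function.comp, Pi.div_apply, e, one_div z]
  rw [Real.mul_rpow (by norm_num) hz.le, Real.rpow_neg (by norm_num)]
  generalize l (1 / 2 * z⁻¹) = q1 at *
  generalize l z⁻¹ = q2 at *
  field_simp

lemma taillim (h l e R : ℝ → ℝ) (F : Filter ℝ) (C α t : ℝ) (ht : 0 < t) (hl : ∀ x > (0:ℝ), 0 < l x)
    (hsv : ∀ lam > (0:ℝ), Tendsto (fun x => l (lam * x) / l x) atTop (nhds 1))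
    (hL : Tendsto (fun z => z ^ α * h z / l (1 / z)) (nhdsWithin 0 (Ioi 0)) (nhds C))
    (hR : Tendsto R F atTop) (he : Tendsto (fun ε => e ε * R ε ^ α * l (R ε)) F (nhds 1)) :
    Tendsto (fun ε => e ε * h (t / R ε)) F (nhds (C * t ^ (-α))) := by
  have t2 : Tendsto (fun ε => t / R ε) F (nhdsWithin 0 (Ioi 0)) := by
    refine tendsto_nhdsWithin_iff.2 ⟨hR.const_div_atTop t, ?_⟩
    filter_upwards [hR.eventually_gt_atTop 0] with ε hε
    exact div_pos ht hε
  have h1 := (((hsv (1 / t) (by positivity)).comp hR).mul he).mul ((hL.comp t2).mul_const (t ^ (-α)))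
  rw [one_mul, one_mul] at h1
  refine h1.congr' ?_
  filter_upwards [hR.eventually_gt_atTop 0] with ε hε
  have e1 : 1 / (t / R ε) = 1 / t * R ε := by field_simp
  have p1 := hl (1 / t * R ε) (by positivity)
  have p2 := hl (R ε) hε
  simp only [Function.comp, e1]
  rw [Real.div_rpow ht.le hε.le, Real.rpow_neg ht.le]
  generalize l (1 / t * R ε) = q1 at *
  field_simp

lemma dens_Ici (C α t : ℝ) (hC : 0 ≤ C) (hα : 0 < α) (ht : 0 < t) :
    ∫⁻ z in Ici t, ENNReal.ofReal (C * α * z ^ (-1 - α)) = ENNReal.ofReal (C * t ^ (-α)) := by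
  rw [setLIntegral_congr Ioi_ae_eq_Ici.symm, ← ofReal_integral_eq_lintegral_ofReal]
  · rw [integral_const_mul, integral_Ioi_rpow_of_lt (by linarith) ht]
    congr 1
    rw [show -1 - α + 1 = -α by ring]
    field_simp
  · exact (integrableOn_Ioi_rpow_of_lt (by linarith) ht).const_mul _
  · filter_upwards [ae_restrict_mem measurableSet_Ioi] with z hz
    have : 0 < z := ht.trans hz
    show 0 ≤ C * α * z ^ (-1 - α)
    positivity

lemma sfin (ν : Measure ℝ) (hν0 : ν {0} = 0)
    (hνfin : ∀ c > (0:ℝ), ν ((Set.Ioo (-c) c)ᶜ) ≠ ⊤) : SFinite ν := by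
  have : SigmaFinite ν := by
    refine ⟨⟨⟨fun n => {0} ∪ (Set.Ioo (-(1 / ((n:ℝ) + 1))) (1 / ((n:ℝ) + 1)))ᶜ, fun n => trivial, fun n => ?_, ?_⟩⟩⟩
    · refine (measure_union_le _ _).trans_lt ?_
      rw [hν0, zero_add]
      exact (hνfin _ (by positivity)).lt_top
    · refine eq_univ_of_forall fun x => mem_iUnion.2 ?_
      by_cases hx : x = 0
      · exact ⟨0, Or.inl hx⟩
      · obtain ⟨n, hn⟩ := exists_nat_one_div_lt (abs_pos.2 hx)
        refine ⟨n, Or.inr fun h => ?_⟩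
        exact absurd (abs_lt.2 h) (not_lt.2 hn.le)
  infer_instance



/-- Convergence of the compensated Fourier integrals of the rescaled jump
measures `ν_ε` to that of the stable jump measure `ν^{(α)}`. -/
theorem stmt_3 (α Cp Cm M : ℝ) (hα : α ∈ Set.Ioo (1:ℝ) 2)
    (hCp : 0 ≤ Cp) (hCm : 0 ≤ Cm) (hCpm : 0 < Cp + Cm) (hM : 0 < M)
    (ν : Measure ℝ)
    (hν0 : ν {0} = 0)
    (hν2 : ∫⁻ z in Set.Icc (-1:ℝ) 1, ENNReal.ofReal (z ^ 2) ∂ν ≠ ⊤)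
    (hνM : ν ((Set.Icc (-M) M)ᶜ) = 0)
    (hνMpt : ν {-M, M} = 0)
    (hνfin : ∀ c > (0:ℝ), ν ((Set.Ioo (-c) c)ᶜ) ≠ ⊤)
    (lν : ℝ → ℝ)
    (hlν_cont : ContinuousOn lν (Set.Ioi 0)) (hlν_pos : ∀ x > (0:ℝ), 0 < lν x)
    (hlν_sv : ∀ lam > (0:ℝ), Tendsto (fun x => lν (lam * x) / lν x) atTop (nhds 1))
    (htail_p : Tendsto (fun z => z ^ α * (ν (Set.Ici z)).toReal / lν (1 / z))
      (nhdsWithin 0 (Set.Ioi 0)) (nhds Cp))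
    (htail_m : Tendsto (fun z => z ^ α * (ν (Set.Iic (-z))).toReal / lν (1 / z))
      (nhdsWithin 0 (Set.Ioi 0)) (nhds Cm))
    (e' e'' : ℝ → ℝ)
    (he'_cont : ContinuousOn e' (Set.Ioc 0 1)) (he''_cont : ContinuousOn e'' (Set.Ioc 0 1))
    (hpos : ∀ ε ∈ Set.Ioc (0:ℝ) 1, 0 < e' ε ∧ 0 < e'' ε)
    (he' : Tendsto e' (nhdsWithin 0 (Set.Ioi 0)) (nhds 0))
    (he'' : Tendsto e'' (nhdsWithin 0 (Set.Ioi 0)) (nhds 0))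
    (he''e : Tendsto (fun ε => e'' ε / ε) (nhdsWithin 0 (Set.Ioi 0)) (nhds 0))
    (hscale : Tendsto (fun ε => e' ε * (ε / e'' ε) ^ α * lν (ε / e'' ε))
      (nhdsWithin 0 (Set.Ioi 0)) (nhds 1)) :
    ∀ lam : ℝ,
      Tendsto
        (fun ε =>
          ∫ z : ℝ,
            (Complex.exp (Complex.I * (lam : ℂ) * (z : ℂ)) - 1 - Complex.I * (lam : ℂ) * (z : ℂ))
            ∂((ENNReal.ofReal (e' ε)) • (Measure.map (fun z : ℝ => (ε / e'' ε) * z) ν)))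
        (nhdsWithin 0 (Set.Ioi 0))
        (nhds
          (∫ z : ℝ,
            (Complex.exp (Complex.I * (lam : ℂ) * (z : ℂ)) - 1 - Complex.I * (lam : ℂ) * (z : ℂ))
            ∂(volume.withDensity (fun z : ℝ =>
                ENNReal.ofReal
                  ((if 0 < z then Cp else if z < 0 then Cm else 0) * α * |z| ^ (-1 - α)))))) := by
  intro lam
  obtain ⟨hα1, hα2⟩ := hα
  have := sfin ν hν0 hνfin
  have hα0 : 0 < α := by linarith
  set a := (1 + α) / 2 with ha
  set b := (2 + α) / 2 with hb
  have hfp : ∀ z > (0:ℝ), ν (Ici z) ≠ ⊤ := fun z hz =>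
    ne_top_of_le_ne_top (hνfin z hz) (measure_mono fun x hx h => absurd h.2 (not_lt.2 hx))
  have hfm : ∀ z > (0:ℝ), ν (Iic (-z)) ≠ ⊤ := fun z hz =>
    ne_top_of_le_ne_top (hνfin z hz) (measure_mono fun x hx h => absurd h.1 (not_lt.2 hx))
  let H : ℝ → ℝ := fun z => (ν (Ici z)).toReal + (ν (Iic (-z))).toReal
  have hH0 : ∀ z, 0 ≤ H z := fun z => by positivity
  have hanti : ∀ x y, 0 < x → x ≤ y → H y ≤ H x := by
    intro x y hx hxy
    refine add_le_add (ENNReal.toReal_mono (hfp x hx) (measure_mono (Ici_subset_Ici.2 hxy)))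
      (ENNReal.toReal_mono (hfm x hx) (measure_mono (Iic_subset_Iic.2 (by linarith))))
  have hHM : ∀ x, M < x → H x = 0 := by
    intro x hx
    have h1 : ν (Ici x) = 0 := measure_mono_null (t := (Icc (-M) M)ᶜ) (fun y hy (h : y ∈ Icc (-M) M) => by
      have := h.2; have : x ≤ y := hy; linarith) hνM
    have h2 : ν (Iic (-x)) = 0 := measure_mono_null (t := (Icc (-M) M)ᶜ) (fun y hy (h : y ∈ Icc (-M) M) => by
      have := h.1; have : y ≤ -x := hy; linarith) hνM
    simp [H, h1, h2]
  have hHL : Tendsto (fun z => z ^ α * H z / lν (1 / z)) (nhdsWithin 0 (Ioi 0)) (nhds (Cp + Cm)) := by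
    refine (htail_p.add htail_m).congr fun z => ?_
    simp only [H]; ring
  obtain ⟨hr, hHpos⟩ := ratio H lν (Cp + Cm) α hCpm hlν_pos hlν_sv hHL
  have hev : ∀ᶠ z in nhdsWithin (0:ℝ) (Ioi 0), H (2 * z) ≤ 2 ^ (-a) * H z ∧ H z ≤ 2 ^ b * H (2 * z) := by
    have h1 : (2:ℝ) ^ (-α) < 2 ^ (-a) := Real.rpow_lt_rpow_of_exponent_lt one_lt_two (by linarith)
    have h2 : (2:ℝ) ^ (-b) < 2 ^ (-α) := Real.rpow_lt_rpow_of_exponent_lt one_lt_two (by linarith)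
    filter_upwards [hHpos, hr.eventually (gt_mem_nhds h1), hr.eventually (lt_mem_nhds h2)] with z h3 h4 h5
    rw [div_lt_iff₀ h3] at h4
    rw [lt_div_iff₀ h3, Real.rpow_neg (by norm_num), inv_mul_lt_iff₀ (by positivity)] at h5
    exact ⟨h4.le, h5.le⟩
  obtain ⟨u, hu, hsub⟩ := mem_nhdsGT_iff_exists_Ioc_subset.1 hev
  have hu : 0 < u := hu
  obtain ⟨K, hK, hpot⟩ := potter H a b (min u M) M (by linarith) (by linarith) (lt_min hu hM)
    (min_le_right _ _) hanti hH0 hHM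
    (fun z hz hz' => (hsub ⟨hz, hz'.trans (min_le_left _ _)⟩).1)
    (fun z hz hz' => (hsub ⟨hz, hz'.trans (min_le_left _ _)⟩).2)
  let R : ℝ → ℝ := fun ε => ε / e'' ε
  have hpos' : ∀ᶠ ε in nhdsWithin (0:ℝ) (Ioi 0), 0 < e' ε ∧ 0 < R ε := by
    filter_upwards [Ioc_mem_nhdsGT (zero_lt_one (α := ℝ))] with ε hε
    exact ⟨(hpos ε hε).1, div_pos hε.1 (hpos ε hε).2⟩
  have hR : Tendsto R (nhdsWithin 0 (Ioi 0)) atTop := by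
    have h1 : Tendsto (fun ε => e'' ε / ε) (nhdsWithin 0 (Ioi 0)) (nhdsWithin 0 (Ioi 0)) := by
      refine tendsto_nhdsWithin_iff.2 ⟨he''e, ?_⟩
      filter_upwards [Ioc_mem_nhdsGT (zero_lt_one (α := ℝ))] with ε hε
      exact div_pos (hpos ε hε).2 hε.1
    refine (tendsto_inv_nhdsGT_zero.comp h1).congr fun ε => ?_
    simp [R]
  let ρ : ℝ → Measure ℝ := fun ε =>
    (ENNReal.ofReal (e' ε)) • (Measure.map (fun z : ℝ => (ε / e'' ε) * z) ν)
  have hρp : ∀ ε, 0 < R ε → ∀ t, ρ ε (Ici t) = ENNReal.ofReal (e' ε) * ν (Ici (t / R ε)) := by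
    intro ε hε t
    simp only [ρ, Measure.smul_apply, smul_eq_mul]
    rw [Measure.map_apply (by fun_prop) measurableSet_Ici]
    congr 2; ext x
    simp only [mem_preimage, mem_Ici]
    rw [div_le_iff₀ hε, mul_comm x]
  have hρm : ∀ ε, 0 < R ε → ∀ t, ρ ε (Iic (-t)) = ENNReal.ofReal (e' ε) * ν (Iic (-(t / R ε))) := by
    intro ε hε t
    simp only [ρ, Measure.smul_apply, smul_eq_mul]
    rw [Measure.map_apply (by fun_prop) measurableSet_Iic]
    congr 2; ext x
    simp only [mem_preimage, mem_Iic]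
    rw [← neg_div, le_div_iff₀ hε, mul_comm x]
  have hρp' : ∀ ε, 0 < e' ε ∧ 0 < R ε → ∀ t, (ρ ε (Ici t)).toReal = e' ε * (ν (Ici (t / R ε))).toReal := by
    intro ε h t
    rw [hρp ε h.2, ENNReal.toReal_mul, ENNReal.toReal_ofReal h.1.le]
  have hρm' : ∀ ε, 0 < e' ε ∧ 0 < R ε → ∀ t,
      (ρ ε (Iic (-t))).toReal = e' ε * (ν (Iic (-(t / R ε)))).toReal := by
    intro ε h t
    rw [hρm ε h.2, ENNReal.toReal_mul, ENNReal.toReal_ofReal h.1.le]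
  have hHb : ∀ᶠ ε in nhdsWithin (0:ℝ) (Ioi 0), ∀ t > 0,
      e' ε * H (t / R ε) ≤ K * (Cp + Cm + 1) * Dfun a b t := by
    have h1 := taillim H lν e' R _ (Cp + Cm) α 1 one_pos hlν_pos hlν_sv hHL hR hscale
    rw [Real.one_rpow, mul_one] at h1
    filter_upwards [h1.eventually (gt_mem_nhds (lt_add_one _)), hpos',
      hR.eventually_ge_atTop (1 / min u M)] with ε h2 h3 h4 t ht
    have h5 := hpot (1 / R ε) (one_div_pos.2 h3.2) ((one_div_le h3.2 (lt_min hu hM)).2 h4) t ht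
    rw [mul_one_div] at h5
    have hD := D_nonneg a b t ht
    calc e' ε * H (t / R ε) ≤ e' ε * (K * Dfun a b t * H (1 / R ε)) :=
          mul_le_mul_of_nonneg_left h5 h3.1.le
      _ = K * Dfun a b t * (e' ε * H (1 / R ε)) := by ring
      _ ≤ K * Dfun a b t * (Cp + Cm + 1) := by gcongr
      _ = _ := by ring
  have T1 := twoside (l := nhdsWithin 0 (Ioi 0)) ρ a b α Cp Cm (K * (Cp + Cm + 1)) lam
    (by linarith) (by linarith)
    (Eventually.of_forall fun ε => by simp only [ρ]; infer_instance)
    (hpos'.mono fun ε h t ht => by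
      rw [hρp ε h.2]; exact ENNReal.mul_ne_top ENNReal.ofReal_ne_top (hfp _ (div_pos ht h.2)))
    (hpos'.mono fun ε h t ht => by
      rw [hρm ε h.2]; exact ENNReal.mul_ne_top ENNReal.ofReal_ne_top (hfm _ (div_pos ht h.2)))
    (by
      filter_upwards [hpos', hHb] with ε h h' t ht
      rw [hρp' ε h]
      refine le_trans (mul_le_mul_of_nonneg_left ?_ h.1.le) (h' t ht)
      exact le_add_of_nonneg_right ENNReal.toReal_nonneg)
    (by
      filter_upwards [hpos', hHb] with ε h h' t ht
      rw [hρm' ε h]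
      refine le_trans (mul_le_mul_of_nonneg_left ?_ h.1.le) (h' t ht)
      exact le_add_of_nonneg_left ENNReal.toReal_nonneg)
    (fun t ht => (taillim (fun z => (ν (Ici z)).toReal) lν e' R _ Cp α t ht hlν_pos hlν_sv htail_p hR
      hscale).congr' (hpos'.mono fun ε h => (hρp' ε h t).symm))
    (fun t ht => (taillim (fun z => (ν (Iic (-z))).toReal) lν e' R _ Cm α t ht hlν_pos hlν_sv htail_m hR
      hscale).congr' (hpos'.mono fun ε h => (hρm' ε h t).symm))
  set μ : Measure ℝ := volume.withDensity (fun z : ℝ => ENNReal.ofReal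
    ((if 0 < z then Cp else if z < 0 then Cm else 0) * α * |z| ^ (-1 - α))) with hμ
  have hμp : ∀ t > 0, μ (Ici t) = ENNReal.ofReal (Cp * t ^ (-α)) := by
    intro t ht
    rw [hμ, withDensity_apply _ measurableSet_Ici, ← dens_Ici Cp α t hCp hα0 ht]
    refine setLIntegral_congr_fun measurableSet_Ici fun z hz => ?_
    have : 0 < z := lt_of_lt_of_le ht hz
    simp only [if_pos this, abs_of_pos this]
  have hμm : ∀ t > 0, μ (Iic (-t)) = ENNReal.ofReal (Cm * t ^ (-α)) := by
    intro t ht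
    rw [hμ, withDensity_apply _ measurableSet_Iic, ← dens_Ici Cm α t hCm hα0 ht]
    rw [show Iic (-t) = (Neg.neg '' Ici t : Set ℝ) by simp]
    rw [← (Measure.measurePreserving_neg (volume : Measure ℝ)).setLIntegral_comp_emb
      (MeasurableEquiv.neg ℝ).measurableEmbedding]
    refine setLIntegral_congr_fun measurableSet_Ici fun z hz => ?_
    have hz' : t ≤ z := hz
    have h1 : -z < 0 := by linarith
    simp only [if_neg h1.not_gt, if_pos h1, abs_of_neg h1, neg_neg]
  have hDα : ∀ t > 0, t ^ (-α) ≤ Dfun a b t := by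
    intro t ht
    unfold Dfun
    split_ifs with h
    · exact Real.rpow_le_rpow_of_exponent_ge ht h (by linarith)
    · exact Real.rpow_le_rpow_of_exponent_le (by linarith) (by linarith)
  have hbound : ∀ C, 0 ≤ C → C ≤ Cp + Cm → ∀ t > 0,
      (ENNReal.ofReal (C * t ^ (-α))).toReal ≤ (Cp + Cm) * Dfun a b t := by
    intro C h0 h1 t ht
    rw [ENNReal.toReal_ofReal (by positivity)]
    exact mul_le_mul h1 (hDα t ht) (by positivity) hCpm.le
  have T2 := twoside (l := nhdsWithin (0:ℝ) (Ioi 0)) (fun _ => μ) a b α Cp Cm (Cp + Cm) lam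
    (by linarith) (by linarith)
    (Eventually.of_forall fun ε => by simp only [hμ]; infer_instance)
    (Eventually.of_forall fun ε t ht => by rw [hμp t ht]; exact ENNReal.ofReal_ne_top)
    (Eventually.of_forall fun ε t ht => by rw [hμm t ht]; exact ENNReal.ofReal_ne_top)
    (Eventually.of_forall fun ε t ht => by rw [hμp t ht]; exact hbound Cp hCp (by linarith) t ht)
    (Eventually.of_forall fun ε t ht => by rw [hμm t ht]; exact hbound Cm hCm (by linarith) t ht)
    (fun t ht => by
      simp only [hμp t ht]; rw [ENNReal.toReal_ofReal (by positivity)]; exact tendsto_const_nhds)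
    (fun t ht => by
      simp only [hμm t ht]; rw [ENNReal.toReal_ofReal (by positivity)]; exact tendsto_const_nhds)
  have e := tendsto_nhds_unique T2 tendsto_const_nhds
  rw [e] at T1
  exact T1
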